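/- arXiv:math/0602342 — 2 statements merged into one kernel-verified Lean document; each statement's English description precedes it below -/
import Mathlib

section
/- Let n ≥ 2 and let n_1, ..., n_k be distinct elements of Z_n satisfying the hypothesis of the permutation criterion: for every j ∈ {2,3,...,n−1} there exist l_j ∈ Z_n and a permutation π_j of {1,...,k} such that either j·n_i − n_{π_j(i)} ≡ l_j (mod n) for all i, or j·n_i + n_{π_j(i)} ≡ l_j (mod n) for all i. Then {n_1,...,n_k} is an (n,k,λ)-difference set in Z_n with λ = k(k−1)/(n−1). -/
/-- `D ⊆ ZMod n` with `|D| = k` is an `(n,k,λ)`-difference set: every nonzero `r ∈ ZMod n`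
can be written as a difference of two elements of `D` in exactly `λ` (ordered) ways. -/
def IsDiffSet (n k lam : ℕ) (D : Finset (ZMod n)) : Prop :=
  D.card = k ∧ ∀ r : ZMod n, r ≠ 0 →
    ((D ×ˢ D).filter (fun p => p.1 - p.2 = r)).card = lam

/-- Counting the pairs of distinct elements of a difference set. -/
theorem IsDiffSet.lam_mul_eq {n k lam : ℕ} [NeZero n] {D : Finset (ZMod n)}
    (h : IsDiffSet n k lam D) : lam * (n - 1) = k * (k - 1) := by
  have hmaps : ∀ p ∈ D.offDiag, p.1 - p.2 ∈ (Finset.univ.erase 0 : Finset (ZMod n)) := by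
    intro p hp
    simpa [sub_eq_zero] using (Finset.mem_offDiag.1 hp).2.2
  have hsum := Finset.card_eq_sum_card_fiberwise hmaps
  have hfiber : ∀ r ∈ (Finset.univ.erase 0 : Finset (ZMod n)),
      (D.offDiag.filter (fun p => p.1 - p.2 = r)).card = lam := by
    intro r hr
    have hr0 : r ≠ 0 := Finset.ne_of_mem_erase hr
    rw [← h.2 r hr0]
    congr 1
    ext ⟨a, b⟩
    simp only [Finset.mem_filter, Finset.mem_offDiag, Finset.mem_product]
    refine ⟨fun ⟨⟨ha, hb, _⟩, he⟩ => ⟨⟨ha, hb⟩, he⟩, fun ⟨⟨ha, hb⟩, he⟩ => ⟨⟨ha, hb, ?_⟩, he⟩⟩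
    rintro rfl
    exact hr0 (by simpa using he.symm)
  rw [Finset.sum_congr rfl hfiber, Finset.offDiag_card, h.1] at hsum
  simp only [Finset.sum_const, Finset.card_erase_of_mem (Finset.mem_univ _), Finset.card_univ,
    ZMod.card, smul_eq_mul] at hsum
  rw [mul_comm, ← hsum, Nat.mul_sub_one]

theorem card_filter_sub_image {ι G : Type*} [Fintype ι] [AddGroup G] [DecidableEq G]
    {m : ι → G} (hm : Function.Injective m) (r : G) :
    ((Finset.univ.image m ×ˢ Finset.univ.image m).filter (fun p => p.1 - p.2 = r)).card =
      (Finset.univ.filter (fun p : ι × ι => m p.1 - m p.2 = r)).card := by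
  rw [← Finset.card_image_of_injective _ (hm.prodMap hm)]
  congr 1
  ext ⟨a, b⟩
  simp only [Finset.mem_filter, Finset.mem_product, Finset.mem_image, Finset.mem_univ, true_and,
    Prod.exists, Prod.map_apply, Prod.mk.injEq]
  constructor
  · rintro ⟨⟨⟨i, rfl⟩, i', rfl⟩, h⟩
    exact ⟨i, i', h, rfl, rfl⟩
  · rintro ⟨i, i', h, rfl, rfl⟩
    exact ⟨⟨⟨i, rfl⟩, i', rfl⟩, h⟩

/-- `c • m` is a translate of `m` or of `-m`, up to reindexing by a permutation. -/
def IsSignedTranslate {ι R : Type*} [Ring R] (m : ι → R) (c : R) : Prop :=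
  ∃ (l : R) (π : Equiv.Perm ι),
    (∀ i, c * m i - m (π i) = l) ∨ (∀ i, c * m i + m (π i) = l)

namespace IsSignedTranslate

variable {ι R : Type*} [Ring R] {m : ι → R} {c : R}

theorem one : IsSignedTranslate m 1 :=
  ⟨0, Equiv.refl ι, Or.inl fun i => by simp⟩

theorem injective_mul (h : IsSignedTranslate m c) (hm : Function.Injective m) :
    Function.Injective (fun i => c * m i) := by
  obtain ⟨l, π, h | h⟩ := h <;> intro i i' (he : c * m i = c * m i') <;>
    have h2 := (h i).trans (h i').symm <;> rw [he] at h2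
  · exact π.injective (hm (sub_right_injective h2))
  · exact π.injective (hm (add_left_cancel h2))

theorem exists_perm_sub (h : IsSignedTranslate m c) :
    ∃ σ : Equiv.Perm (ι × ι), ∀ p, m (σ p).1 - m (σ p).2 = c * (m p.1 - m p.2) := by
  obtain ⟨l, π, h | h⟩ := h
  · refine ⟨Equiv.prodCongr π π, fun p => ?_⟩
    have h2 := (h p.1).trans (h p.2).symm
    simp only [Equiv.prodCongr_apply, Prod.map_fst, Prod.map_snd]
    rw [mul_sub]
    rw [sub_eq_sub_iff_add_eq_add] at h2 ⊢
    rw [add_comm, add_comm (c * m p.1), add_comm (m (π p.2)), h2, add_comm]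
  · refine ⟨(Equiv.prodCongr π π).trans (Equiv.prodComm ι ι), fun p => ?_⟩
    have h2 := (h p.1).trans (h p.2).symm
    simp only [Equiv.trans_apply, Equiv.prodCongr_apply, Equiv.prodComm_apply, Prod.fst_swap,
      Prod.snd_swap, Prod.map_fst, Prod.map_snd]
    rw [mul_sub, sub_eq_sub_iff_add_eq_add, h2, add_comm]

/-- If `c` is cancellable, then `c` is a difference of values of `m` as often as `1` is. -/
theorem card_filter_sub_eq [Fintype ι] [DecidableEq R] (h : IsSignedTranslate m c)
    (hc : IsLeftRegular c) :
    (Finset.univ.filter (fun p : ι × ι => m p.1 - m p.2 = c)).card =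
      (Finset.univ.filter (fun p : ι × ι => m p.1 - m p.2 = 1)).card := by
  obtain ⟨σ, hσ⟩ := h.exists_perm_sub
  refine (Finset.card_equiv σ fun p => ?_).symm
  simp only [Finset.mem_filter, Finset.mem_univ, true_and, hσ]
  exact ⟨fun hp => by rw [hp, mul_one], fun hp => hc (by simpa using hp)⟩

/-- A family that is a signed translate of both its multiples by `a` and `b` with `a * b = 0`
has at most one member. -/
theorem subsingleton_of_mul_eq_zero {a b : R} (hm : Function.Injective m)
    (ha : IsSignedTranslate m a) (hb : IsSignedTranslate m b) (hab : a * b = 0) :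
    Subsingleton ι := by
  refine ⟨fun i i' => ?_⟩
  obtain ⟨σ, hσ⟩ := hb.exists_perm_sub
  have h := hσ (σ.symm (i, i'))
  rw [Equiv.apply_symm_apply] at h
  refine ha.injective_mul hm (sub_eq_zero.1 ?_)
  rw [← mul_sub, h, ← mul_assoc, hab, zero_mul]

end IsSignedTranslate

theorem stmt7 (n k : ℕ) (hn : 2 ≤ n)
    (m : Fin k → ZMod n) (hm : Function.Injective m)
    -- the permutation criterion: for every `j ∈ {2,...,n-1}` there are `l_j` and `π_j` with
    -- `j·m i − m (π_j i) ≡ l_j (mod n)` for all `i`, or `j·m i + m (π_j i) ≡ l_j (mod n)` for all `i`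
    (hperm : ∀ j : ℕ, 2 ≤ j → j ≤ n - 1 →
      ∃ (l : ZMod n) (π : Equiv.Perm (Fin k)),
        (∀ i, (j : ZMod n) * m i - m (π i) = l) ∨
        (∀ i, (j : ZMod n) * m i + m (π i) = l)) :
    -- `{m 1,...,m k}` is an `(n,k,λ)`-difference set with `λ = k(k-1)/(n-1)`
    ∃ lam : ℕ, IsDiffSet n k lam (Finset.image m Finset.univ) ∧
      lam * (n - 1) = k * (k - 1) := by
  have : NeZero n := ⟨by omega⟩
  suffices h : ∃ lam : ℕ, IsDiffSet n k lam (Finset.image m Finset.univ) from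
    h.imp fun _ h => ⟨h, h.lam_mul_eq⟩
  have hcard : (Finset.image m Finset.univ).card = k := by
    rw [Finset.card_image_of_injective _ hm, Finset.card_fin]
  have htrans : ∀ j : ℕ, 1 ≤ j → j < n → IsSignedTranslate m (j : ZMod n) := by
    intro j hj hjn
    rcases hj.eq_or_lt with rfl | hj
    · simpa using IsSignedTranslate.one
    · exact hperm j hj (by omega)
  by_cases hp : n.Prime
  · have : Fact n.Prime := ⟨hp⟩
    refine ⟨(Finset.univ.filter (fun p : Fin k × Fin k => m p.1 - m p.2 = 1)).card, hcard,
      fun r hr => ?_⟩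
    have hr' := htrans r.val (Nat.pos_of_ne_zero ((ZMod.val_ne_zero r).2 hr)) r.val_lt
    rw [ZMod.natCast_zmod_val] at hr'
    rw [card_filter_sub_image hm, hr'.card_filter_sub_eq (mul_right_injective₀ hr)]
  · obtain ⟨a, b, ha, hb, hab⟩ := (Nat.not_prime_iff_exists_mul_eq hn).1 hp
    have ha0 : 1 ≤ a := Nat.pos_of_ne_zero (by rintro rfl; omega)
    have hb0 : 1 ≤ b := Nat.pos_of_ne_zero (by rintro rfl; omega)
    have := (htrans a ha0 ha).subsingleton_of_mul_eq_zero hm (htrans b hb0 hb)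
      (by rw [← Nat.cast_mul, hab, ZMod.natCast_self])
    refine ⟨0, hcard, fun r hr => ?_⟩
    rw [card_filter_sub_image hm, Finset.card_eq_zero, Finset.filter_eq_empty_iff]
    rintro ⟨i, i'⟩ - he
    exact hr (by rw [← he, Subsingleton.elim i i', sub_self])
end

section
/- Let n be a prime with n ≡ 3 (mod 4) and write k = (n−1)/2. Then the set Q of nonzero quadratic residues modulo n is an (n, (n−1)/2, (n−3)/4)-difference set in Z_n, and the set Q ∪ {0} is an (n, (n+1)/2, (n+1)/4)-difference set in Z_n. -/
section QuadraticChar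

variable {F : Type*} [Field F] [Fintype F] [DecidableEq F]

/-- The autocorrelation of the quadratic character at a nonzero shift is `-1`. -/
theorem sum_quadraticChar_mul_shift (hF : ringChar F ≠ 2) {r : F} (hr : r ≠ 0) :
    ∑ b : F, quadraticChar F b * quadraticChar F (b + r) = -1 := by
  have hJ := jacobiSum_nontrivial_inv (quadraticChar_ne_one hF)
  rw [(quadraticChar_isQuadratic F).inv, jacobiSum] at hJ
  rw [← Equiv.sum_comp (Equiv.mulLeft₀ (-r) (neg_ne_zero.mpr hr))]
  calc ∑ x : F, quadraticChar F (-r * x) * quadraticChar F (-r * x + r)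
      = ∑ x : F, quadraticChar F (-1) * (quadraticChar F x * quadraticChar F (1 - x)) := by
        refine Finset.sum_congr rfl fun x _ => ?_
        rw [show -r * x = -1 * r * x by ring, show -1 * r * x + r = r * (1 - x) by ring]
        simp only [map_mul]
        linear_combination (quadraticChar F (-1) * quadraticChar F x * quadraticChar F (1 - x)) *
          quadraticChar_sq_one hr
    _ = -1 := by
        rw [← Finset.mul_sum, hJ]
        linear_combination -quadraticChar_sq_one (neg_ne_zero.mpr (one_ne_zero (α := F)))

/-- The size of a set whose doubled indicator is `1 + χ + s δ₀`, with `χ` the quadratic character. -/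
theorem two_mul_card_of_indicator (hF : ringChar F ≠ 2) {D : Finset F} {s : ℤ}
    (hD : ∀ a, 2 * (if a ∈ D then 1 else 0 : ℤ) =
      1 + quadraticChar F a + s * (if a = 0 then 1 else 0)) :
    2 * (D.card : ℤ) = Fintype.card F + s := by
  have h : (D.card : ℤ) = ∑ a : F, if a ∈ D then 1 else 0 := by simp
  rw [h, Finset.mul_sum, Finset.sum_congr rfl fun a _ => hD a]
  simp only [Finset.sum_add_distrib, quadraticChar_sum_zero hF]
  simp

/-- The number of representations of a nonzero `r` as a difference in a set whose doubled indicator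
is `1 + χ + s δ₀`, with `χ` the quadratic character, when `-1` is not a square. -/
theorem four_mul_card_sub_eq_of_indicator (hF : ringChar F ≠ 2)
    (hneg : quadraticChar F (-1) = -1) {D : Finset F} {s : ℤ}
    (hD : ∀ a, 2 * (if a ∈ D then 1 else 0 : ℤ) =
      1 + quadraticChar F a + s * (if a = 0 then 1 else 0)) {r : F} (hr : r ≠ 0) :
    4 * (((D ×ˢ D).filter (fun p => p.1 - p.2 = r)).card : ℤ) =
      Fintype.card F - 1 + 2 * s := by
  have hcard : ((D ×ˢ D).filter (fun p => p.1 - p.2 = r)).card =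
      (Finset.univ.filter fun b : F => b ∈ D ∧ b + r ∈ D).card := by
    refine Finset.card_nbij' Prod.snd (fun b => (b + r, b)) ?_ ?_ ?_ ?_
    · rintro ⟨a, b⟩ h
      simp only [Finset.coe_filter, Finset.mem_product, Set.mem_ofPred_eq] at h
      simp [h.1.2, ← h.2, h.1.1]
    · intro b h
      simp_all
    · rintro ⟨a, b⟩ h
      simp only [Finset.coe_filter, Finset.mem_product, Set.mem_ofPred_eq] at h
      simp [← h.2]
    · intro b _
      rfl
  have hshift : ∑ b : F, quadraticChar F (b + r) = 0 := by
    rw [← quadraticChar_sum_zero hF]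
    exact Equiv.sum_comp (Equiv.addRight r) (quadraticChar F)
  have hnegr : quadraticChar F (-r) = -quadraticChar F r := by
    rw [← neg_one_mul, map_mul, hneg, neg_one_mul]
  calc 4 * (((D ×ˢ D).filter (fun p => p.1 - p.2 = r)).card : ℤ)
      = ∑ b : F, (2 * (if b ∈ D then 1 else 0 : ℤ)) * (2 * (if b + r ∈ D then 1 else 0)) := by
        rw [hcard, Finset.card_filter, Nat.cast_sum, Finset.mul_sum]
        refine Finset.sum_congr rfl fun b _ => ?_
        by_cases h₁ : b ∈ D <;> by_cases h₂ : b + r ∈ D <;> simp [h₁, h₂]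
    _ = ∑ b : F, (1 + quadraticChar F b + quadraticChar F (b + r)
          + quadraticChar F b * quadraticChar F (b + r)
          + (if b = 0 then s * (1 + quadraticChar F r) else 0)
          + (if b = -r then s * (1 + quadraticChar F (-r)) else 0)) := by
        refine Finset.sum_congr rfl fun b _ => ?_
        rw [hD, hD]
        by_cases h₁ : b = 0
        · subst h₁
          simp [hr]
          ring
        · by_cases h₂ : b = -r
          · subst h₂
            simp [hr]
            ring
          · have h₃ : b + r ≠ 0 := fun h => h₂ (eq_neg_of_add_eq_zero_left h)
            simp [h₁, h₂, h₃]
            ring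
    _ = Fintype.card F - 1 + 2 * s := by
        simp only [Finset.sum_add_distrib, hshift, quadraticChar_sum_zero hF,
          sum_quadraticChar_mul_shift hF hr, hnegr]
        simp
        ring

end QuadraticChar

theorem stmt13 (n : ℕ) [NeZero n] (hp : n.Prime) (h3 : n % 4 = 3) :
    -- the set `Q` of nonzero quadratic residues mod `n` is an
    -- `(n, (n-1)/2, (n-3)/4)`-difference set, and `Q ∪ {0}` is an
    -- `(n, (n+1)/2, (n+1)/4)`-difference set
    IsDiffSet n ((n - 1) / 2) ((n - 3) / 4)
      (Finset.univ.filter (fun a : ZMod n => a ≠ 0 ∧ ∃ x : ZMod n, x ^ 2 = a)) ∧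
    IsDiffSet n ((n + 1) / 2) ((n + 1) / 4)
      (insert (0 : ZMod n)
        (Finset.univ.filter (fun a : ZMod n => a ≠ 0 ∧ ∃ x : ZMod n, x ^ 2 = a))) := by
  have : Fact n.Prime := ⟨hp⟩
  have hF : ringChar (ZMod n) ≠ 2 := by
    rw [ZMod.ringChar_zmod_n]
    omega
  have hneg : quadraticChar (ZMod n) (-1) = -1 := by
    rw [quadraticChar_neg_one_iff_not_isSquare, FiniteField.isSquare_neg_one_iff, ZMod.card]
    exact not_not.mpr h3
  have hmem (a : ZMod n) (ha : a ≠ 0) :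
      (∃ x : ZMod n, x ^ 2 = a) ↔ quadraticChar (ZMod n) a = 1 := by
    rw [quadraticChar_one_iff_isSquare ha, isSquare_iff_exists_sq]
    simp only [eq_comm]
  have hQ (a : ZMod n) : 2 * (if a ∈ Finset.univ.filter
      (fun a : ZMod n => a ≠ 0 ∧ ∃ x : ZMod n, x ^ 2 = a) then 1 else 0 : ℤ) =
      1 + quadraticChar (ZMod n) a + (-1) * (if a = 0 then 1 else 0) := by
    by_cases ha : a = 0
    · simp [ha]
    · rcases quadraticChar_dichotomy ha with h | h <;> simp [ha, hmem a ha, h]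
  have hQ₀ (a : ZMod n) : 2 * (if a ∈ insert 0 (Finset.univ.filter
      (fun a : ZMod n => a ≠ 0 ∧ ∃ x : ZMod n, x ^ 2 = a)) then 1 else 0 : ℤ) =
      1 + quadraticChar (ZMod n) a + 1 * (if a = 0 then 1 else 0) := by
    by_cases ha : a = 0
    · simp [ha]
    · rcases quadraticChar_dichotomy ha with h | h <;> simp [ha, hmem a ha, h]
  refine ⟨⟨?_, fun r hr => ?_⟩, ⟨?_, fun r hr => ?_⟩⟩
  · have h := two_mul_card_of_indicator hF hQ
    rw [ZMod.card] at h
    omega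
  · have h := four_mul_card_sub_eq_of_indicator hF hneg hQ hr
    rw [ZMod.card] at h
    omega
  · have h := two_mul_card_of_indicator hF hQ₀
    rw [ZMod.card] at h
    omega
  · have h := four_mul_card_sub_eq_of_indicator hF hneg hQ₀ hr
    rw [ZMod.card] at h
    omega
end
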